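/- For every real number t > 0, define V₂(t) = 2t(2 + 2t⁻³) if t⁻³ ≤ 1 and V₂(t) = 8t if t⁻³ ≥ 1. Then V₂(t) ∈ E(t), and every element e of E(t) with e ≠ t(2 + t⁻³) satisfies e ≥ V₂(t). -/

import Mathlib

/-- `γ_n(t) = t·n·(2 + n·t⁻³)` -/
noncomputable def gammaF (t : ℝ) (n : ℕ) : ℝ := t * n * (2 + n * (t ^ 3)⁻¹)

/-- `α_k(t) = t·(k(k+2) − 1 + t⁻³)` -/
noncomputable def alphaF (t : ℝ) (k : ℕ) : ℝ := t * (k * (k + 2) - 1 + (t ^ 3)⁻¹)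

/-- `β_l(t) = t·l·(l+2)` -/
noncomputable def betaF (t : ℝ) (l : ℕ) : ℝ := t * l * (l + 2)

/-- The set `E(t)` of nonzero eigenvalues of the unit-volume Berger sphere Laplacian. -/
def EV (t : ℝ) : Set ℝ :=
  {x | ∃ n : ℕ, 1 ≤ n ∧ x = gammaF t n} ∪
  {x | ∃ k : ℕ, Odd k ∧ 1 ≤ k ∧ x = alphaF t k} ∪
  {x | ∃ l : ℕ, Even l ∧ 2 ≤ l ∧ x = betaF t l}

theorem berger_lambda2 (t : ℝ) (ht : 0 < t) :
    ∃ V : ℝ,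
      ((t ^ 3)⁻¹ ≤ 1 → V = 2 * t * (2 + 2 * (t ^ 3)⁻¹)) ∧
      (1 ≤ (t ^ 3)⁻¹ → V = 8 * t) ∧
      V ∈ EV t ∧
      ∀ e ∈ EV t, e ∉ ({t * (2 + (t ^ 3)⁻¹)} : Set ℝ) → V ≤ e := by
  obtain ⟨s, hs⟩ : ∃ s, s = (t ^ 3)⁻¹ := ⟨_, rfl⟩
  have hs0 : 0 < s := by rw [hs]; positivity
  have key : ∀ c : ℝ, c ≤ 4 + 4 * s → c ≤ 8 →
      ∀ e ∈ EV t, e ∉ ({t * (2 + (t ^ 3)⁻¹)} : Set ℝ) → t * c ≤ e := by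
    intro c h1 h2 e he hne
    rw [Set.mem_singleton_iff] at hne
    rcases he with (⟨n, hn, rfl⟩ | ⟨k, hk, hk1, rfl⟩) | ⟨l, hl, hl2, rfl⟩
    · unfold gammaF at hne ⊢
      rw [← hs] at hne ⊢
      have hn2 : 2 ≤ n := by
        by_contra h
        have : n = 1 := by omega
        subst this
        apply hne
        push_cast
        ring
      have h : (2 : ℝ) ≤ n := by exact_mod_cast hn2
      have h4 : (4 : ℝ) ≤ (n : ℝ) * n := by nlinarith
      have h5 : 4 * s ≤ (n : ℝ) * n * s := mul_le_mul_of_nonneg_right h4 hs0.le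
      rw [mul_assoc]
      apply mul_le_mul_of_nonneg_left _ ht.le
      linarith
    · unfold alphaF at hne ⊢
      rw [← hs] at hne ⊢
      have hk3 : 3 ≤ k := by
        by_contra h
        have : k = 1 := by
          obtain ⟨m, rfl⟩ := hk
          omega
        subst this
        apply hne
        push_cast
        ring
      have h : (3 : ℝ) ≤ k := by exact_mod_cast hk3
      apply mul_le_mul_of_nonneg_left _ ht.le
      nlinarith
    · unfold betaF
      have h : (2 : ℝ) ≤ l := by exact_mod_cast hl2
      rw [mul_assoc]
      apply mul_le_mul_of_nonneg_left _ ht.le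
      nlinarith
  rcases le_total s 1 with h | h
  · refine ⟨t * (4 + 4 * s), ?_, ?_, ?_, key _ le_rfl (by linarith)⟩
    · intro _
      rw [← hs]; ring
    · intro h'
      rw [← hs] at h'
      have : s = 1 := le_antisymm h h'
      rw [this]; ring
    · refine Or.inl (Or.inl ⟨2, by norm_num, ?_⟩)
      unfold gammaF
      rw [← hs]; push_cast; ring
  · refine ⟨t * 8, ?_, ?_, ?_, key _ (by linarith) le_rfl⟩
    · intro h'
      rw [← hs] at h' ⊢
      have : s = 1 := le_antisymm h' h
      rw [this]; ring
    · intro _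
      ring
    · refine Or.inr ⟨2, by decide, le_rfl, ?_⟩
      unfold betaF
      push_cast; ring
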